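/- Let p>1, let a∈C^1([0,1]) with a(x)>0 on [0,1], and let W satisfy (W1) and (W2). Let ε_n→0^+ and let u_n be solutions of (P_{ε_n}) whose energies E_n converge uniformly on [0,1] to a function E. Fix x_0∈(0,1) and set v_n(y)=u_n(x_0+ε_n y). Then, up to a subsequence, v_n converges in C^1_loc(ℝ) to a function v̄∈C^1(ℝ) that solves -(φ_p(v̄'))'+a(x_0)W'(v̄)=0 on ℝ with -(1/a(x_0))L(v̄')+W(v̄) ≡ E(x_0). In particular E(x_0)∈[0,W_0], and: if E(x_0)∈(0,W_0) then v̄(x)=v̄_{a(x_0),E(x_0)}(x+t_0) for some t_0∈ℝ; if E(x_0)=W_0 then v̄≡0; if E(x_0)=0 then either v̄≡1, or v̄≡-1, or v̄(x)=v̄_{a(x_0),0}(±x+t_0) for some t_0∈ℝ, where v̄_{a,0} denotes the heteroclinic solution with v̄_{a,0}(0)=0 and v̄'_{a,0}(0)>0. -/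

import Mathlib

open Real Set Filter Topology MeasureTheory intervalIntegral Asymptotics

noncomputable section

/-- `φ_p(s) = |s|^{p-2} s`. -/
def phip (p s : ℝ) : ℝ := |s| ^ (p - 2) * s

/-- `L(s) = |s|^p / p*` with `p* = p/(p-1)`. -/
def Lfun (p s : ℝ) : ℝ := |s| ^ p / (p / (p - 1))

/-- condition (W1) -/
def W1cond (p : ℝ) (W : ℝ → ℝ) (Cm1 C0 C1 W0 : ℝ) : Prop :=
  0 < Cm1 ∧ 0 < C0 ∧ 0 < C1 ∧ 0 < W0 ∧
  (fun u => W u - C1 / p * |u - 1| ^ p) =o[𝓝[Set.Icc (-1:ℝ) 1] 1] (fun u => |u - 1| ^ p) ∧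
  (fun u => W u - Cm1 / p * |u + 1| ^ p) =o[𝓝[Set.Icc (-1:ℝ) 1] (-1)] (fun u => |u + 1| ^ p) ∧
  (fun u => W u - (W0 - C0 / p * |u| ^ p)) =o[𝓝[Set.Icc (-1:ℝ) 1] 0] (fun u => |u| ^ p)

/-- condition (W2) -/
def W2cond (p : ℝ) (W : ℝ → ℝ) : Prop :=
  StrictAntiOn (fun u => deriv W u / phip p u) (Set.Ico (-1:ℝ) 0) ∧
  StrictMonoOn (fun u => deriv W u / phip p u) (Set.Ioc (0:ℝ) 1)

/-- `v` (with derivative `v'`) is a global solution of `-(φ_p(v'))' + a W'(v) = 0`. -/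
def IsSolAuto (p aa : ℝ) (W v v' : ℝ → ℝ) : Prop :=
  Continuous v' ∧ (∀ x, HasDerivAt v (v' x) x) ∧
  ∃ g : ℝ → ℝ, Continuous g ∧ (∀ x, HasDerivAt (fun y => phip p (v' y)) (g x) x) ∧
    ∀ x, g x = aa * deriv W (v x)

/-- `v` (with derivative `v'`) solves `-(φ_p(v'))' + a W'(v) = 0` on the open set `I`. -/
def IsSolAutoOn (p aa : ℝ) (W v v' : ℝ → ℝ) (I : Set ℝ) : Prop :=
  ContinuousOn v' I ∧ (∀ x ∈ I, HasDerivAt v (v' x) x) ∧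
  ∃ g : ℝ → ℝ, ContinuousOn g I ∧ (∀ x ∈ I, HasDerivAt (fun y => phip p (v' y)) (g x) x) ∧
    ∀ x ∈ I, g x = aa * deriv W (v x)

/-- `u` (with derivative `u'`) solves `-ε(φ_p(εu'))' + a(x) W'(u) = 0` on `S`. -/
def IsSolOn (p ε : ℝ) (a W u u' : ℝ → ℝ) (S : Set ℝ) : Prop :=
  ContinuousOn u' S ∧ (∀ x ∈ S, HasDerivWithinAt u (u' x) S x) ∧
  ∃ g : ℝ → ℝ, ContinuousOn g S ∧
    (∀ x ∈ S, HasDerivWithinAt (fun y => phip p (ε * u' y)) (g x) S x) ∧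
    ∀ x ∈ S, ε * g x = a x * deriv W (u x)

/-- `u` is a solution of the Neumann problem `(P_ε)`. -/
def IsNeumann (p ε : ℝ) (a W u u' : ℝ → ℝ) : Prop :=
  IsSolOn p ε a W u u' (Set.Icc 0 1) ∧ u' 0 = 0 ∧ u' 1 = 0

/-- energy of a solution of `(P_ε)` -/
def Ener (p ε : ℝ) (a W u u' : ℝ → ℝ) (x : ℝ) : ℝ :=
  -(1 / a x) * Lfun p (ε * u' x) + W (u x)

/-- `π_p` -/
def pip (p : ℝ) : ℝ := 2 * (p - 1) ^ (1 / p) * ∫ s in (0:ℝ)..1, ((1:ℝ) - s ^ p) ^ (-(1 / p))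

lemma abs_phip {p : ℝ} (hp : 1 < p) (s : ℝ) : |phip p s| = |s| ^ (p - 1) := by
  unfold phip
  rcases eq_or_ne s 0 with rfl | hs
  · simp [Real.zero_rpow (sub_ne_zero.2 hp.ne')]
  · have h : 0 < |s| := abs_pos.2 hs
    rw [abs_mul, abs_of_nonneg (Real.rpow_nonneg h.le _)]
    nth_rewrite 2 [← Real.rpow_one |s|]
    rw [← Real.rpow_add h]
    ring_nf

lemma phip_pos {p s : ℝ} (hs : 0 < s) : 0 < phip p s := by
  unfold phip; positivity

lemma phip_neg (p s : ℝ) : phip p (-s) = -phip p s := by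
  simp [phip]

lemma phip_zero (p : ℝ) : phip p 0 = 0 := by simp [phip]

lemma phip_lt_zero {p s : ℝ} (hs : s < 0) : phip p s < 0 := by
  have := phip_pos (p := p) (neg_pos.2 hs)
  rw [phip_neg] at this
  linarith

lemma continuous_phip {p : ℝ} (hp : 1 < p) : Continuous (phip p) := by
  rw [continuous_iff_continuousAt]
  intro s
  rcases eq_or_ne s 0 with rfl | hs
  · rw [ContinuousAt, phip_zero]
    apply squeeze_zero_norm (a := fun s => |s| ^ (p - 1))
    · intro t
      rw [Real.norm_eq_abs, abs_phip hp]
    · have : Continuous (fun s : ℝ => |s| ^ (p - 1)) :=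
        continuous_abs.rpow_const (fun _ => Or.inr (by linarith))
      simpa [Real.zero_rpow (sub_ne_zero.2 hp.ne')] using this.tendsto 0
  · exact (continuous_abs.continuousAt.rpow_const (Or.inl (abs_ne_zero.2 hs))).mul continuousAt_id

/-- `φ_q` inverts `φ_p` when `q = p / (p - 1)`. -/
lemma phip_conj_phip {p : ℝ} (hp : 1 < p) (s : ℝ) : phip (p / (p - 1)) (phip p s) = s := by
  rcases eq_or_ne s 0 with rfl | hs
  · simp [phip_zero]
  have h : 0 < |s| := abs_pos.2 hs
  have hp1 : p - 1 ≠ 0 := sub_ne_zero.2 hp.ne'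
  rw [phip, abs_phip hp, ← Real.rpow_mul h.le, phip, ← mul_assoc, ← Real.rpow_add h]
  have : (p - 1) * (p / (p - 1) - 2) + (p - 2) = 0 := by field_simp; ring
  rw [this, Real.rpow_zero, one_mul]

lemma one_lt_conj {p : ℝ} (hp : 1 < p) : 1 < p / (p - 1) := by
  rw [one_lt_div (by linarith)]; linarith

lemma conj_conj {p : ℝ} (hp : 1 < p) : p / (p - 1) / (p / (p - 1) - 1) = p := by
  have : p - 1 ≠ 0 := sub_ne_zero.2 hp.ne'
  have h2 : p / (p - 1) - 1 = 1 / (p - 1) := by field_simp; ring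
  rw [h2]; field_simp

lemma phip_phip_conj {p : ℝ} (hp : 1 < p) (s : ℝ) : phip p (phip (p / (p - 1)) s) = s := by
  have := phip_conj_phip (one_lt_conj hp) s
  rwa [conj_conj hp] at this

lemma abs_rpow_eq_abs_phip {p : ℝ} (hp : 1 < p) (s : ℝ) :
    |s| ^ p = |phip p s| ^ (p / (p - 1)) := by
  have hp1 : p - 1 ≠ 0 := sub_ne_zero.2 hp.ne'
  rw [abs_phip hp, ← Real.rpow_mul (abs_nonneg _)]
  congr 1; field_simp

lemma phip_strictMono {p : ℝ} (hp : 1 < p) : StrictMono (phip p) := by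
  have hinj : Function.Injective (phip p) :=
    Function.LeftInverse.injective (phip_conj_phip hp)
  rcases (continuous_phip hp).strictMono_of_inj hinj with h | h
  · exact h
  · have h1 := h (show (0:ℝ) < 1 by norm_num)
    have h2 := phip_pos (p := p) (show (0:ℝ) < 1 by norm_num)
    rw [phip_zero] at h1
    linarith

lemma continuous_Lfun {p : ℝ} (hp : 1 < p) : Continuous (Lfun p) := by
  unfold Lfun
  exact (continuous_abs.rpow_const (fun _ => Or.inr (by linarith))).div_const _

lemma Lfun_nonneg {p : ℝ} (hp : 1 < p) (s : ℝ) : 0 ≤ Lfun p s := by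
  have := one_lt_conj hp
  unfold Lfun; positivity

lemma Lfun_pos {p s : ℝ} (hp : 1 < p) (hs : s ≠ 0) : 0 < Lfun p s := by
  have := one_lt_conj hp
  have := abs_pos.2 hs
  unfold Lfun; positivity

lemma Lfun_zero {p : ℝ} (hp : 1 < p) : Lfun p 0 = 0 := by
  simp [Lfun, Real.zero_rpow (show p ≠ 0 by linarith)]

lemma Lfun_neg (p s : ℝ) : Lfun p (-s) = Lfun p s := by simp [Lfun]

lemma abs_eq_of_Lfun {p : ℝ} (hp : 1 < p) (s : ℝ) :
    |s| = (p / (p - 1) * Lfun p s) ^ (1 / p) := by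
  have h1 : p / (p - 1) ≠ 0 := by have := one_lt_conj hp; positivity
  rw [Lfun, mul_div_cancel₀ _ h1, ← Real.rpow_mul (abs_nonneg _), mul_one_div_cancel (by linarith),
    Real.rpow_one]

/-- The energy identity, solved for the kinetic term. -/
lemma Lfun_eq_of_energy {p aa e l w : ℝ} (ha : 0 < aa) (h : -(1 / aa) * Lfun p l + w = e) :
    Lfun p l = aa * (w - e) := by
  field_simp at h
  linarith

lemma le_of_energy {p aa e l w : ℝ} (hp : 1 < p) (ha : 0 < aa)
    (h : -(1 / aa) * Lfun p l + w = e) : e ≤ w := by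
  have h1 := Lfun_eq_of_energy ha h
  have h2 := Lfun_nonneg hp l
  nlinarith

lemma eq_zero_iff_of_energy {p aa e l w : ℝ} (hp : 1 < p) (ha : 0 < aa)
    (h : -(1 / aa) * Lfun p l + w = e) : l = 0 ↔ w = e := by
  have h1 := Lfun_eq_of_energy ha h
  constructor
  · rintro rfl
    rw [Lfun_zero hp] at h1
    have := (mul_eq_zero.1 h1.symm).resolve_left ha.ne'
    linarith
  · rintro rfl
    by_contra hl
    have := Lfun_pos hp hl
    simp at h1
    linarith

/-- Local uniqueness for a scalar autonomous equation at a nonequilibrium point. -/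
lemma eventuallyEq_of_autonomous {H f g : ℝ → ℝ} {t0 : ℝ}
    (hH : ∀ᶠ x in 𝓝 (f t0), ContinuousAt H x) (hH0 : H (f t0) ≠ 0)
    (hf : ∀ᶠ t in 𝓝 t0, HasDerivAt f (H (f t)) t)
    (hg : ∀ᶠ t in 𝓝 t0, HasDerivAt g (H (g t)) t) (hfg : f t0 = g t0) :
    f =ᶠ[𝓝 t0] g := by
  have hev : ∀ᶠ x in 𝓝 (f t0), ContinuousAt H x ∧ H x ≠ 0 :=
    hH.and (hH.self_of_nhds.eventually_ne hH0)
  obtain ⟨δ, hδ, hball⟩ := Metric.eventually_nhds_iff_ball.1 hev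
  have hcont : ContinuousOn (fun x => (H x)⁻¹) (Metric.ball (f t0) δ) := fun x hx =>
    ((hball x hx).1.inv₀ (hball x hx).2).continuousWithinAt
  have hF : ∀ s ∈ Metric.ball (f t0) δ,
      HasDerivAt (fun s => ∫ r in (f t0)..s, (H r)⁻¹) (H s)⁻¹ s := by
    intro s hs
    have hsub : uIcc (f t0) s ⊆ Metric.ball (f t0) δ := by
      rw [Real.ball_eq_Ioo] at hs ⊢
      exact ordConnected_Ioo.uIcc_subset (by constructor <;> linarith) hs
    refine intervalIntegral.integral_hasDerivAt_right
      (hcont.mono hsub).intervalIntegrable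
      (hcont.stronglyMeasurableAtFilter Metric.isOpen_ball s hs)
      ((hball s hs).1.inv₀ (hball s hs).2)
  set F : ℝ → ℝ := fun s => ∫ r in (f t0)..s, (H r)⁻¹ with hFdef
  have hinj : ∀ x ∈ Metric.ball (f t0) δ, ∀ y ∈ Metric.ball (f t0) δ, x < y → F x ≠ F y := by
    intro x hx y hy hxy hEq
    have hsub : Icc x y ⊆ Metric.ball (f t0) δ := by
      rw [Real.ball_eq_Ioo] at hx hy ⊢
      exact ordConnected_Ioo.out hx hy
    obtain ⟨c, hc, hc0⟩ := exists_hasDerivAt_eq_zero hxy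
      (fun z hz => (hF z (hsub hz)).continuousAt.continuousWithinAt) hEq
      (fun z hz => hF z (hsub (Ioo_subset_Icc_self hz)))
    exact inv_ne_zero (hball c (hsub (Ioo_subset_Icc_self hc))).2 hc0
  have hfb : ∀ᶠ t in 𝓝 t0, f t ∈ Metric.ball (f t0) δ :=
    hf.self_of_nhds.continuousAt.eventually_mem (Metric.ball_mem_nhds _ hδ)
  have hgb : ∀ᶠ t in 𝓝 t0, g t ∈ Metric.ball (f t0) δ := by
    have := hg.self_of_nhds.continuousAt
    rw [ContinuousAt, ← hfg] at this
    exact this.eventually_mem (Metric.ball_mem_nhds _ hδ)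
  obtain ⟨η, hη, hall⟩ := Metric.eventually_nhds_iff_ball.1 ((hf.and hg).and (hfb.and hgb))
  have hD : ∀ t ∈ Metric.ball t0 η, HasDerivAt (fun t => F (f t) - F (g t)) 0 t := by
    intro t ht
    obtain ⟨⟨h1, h2⟩, h3, h4⟩ := hall t ht
    have := ((hF _ h3).comp t h1).sub ((hF _ h4).comp t h2)
    rw [inv_mul_cancel₀ (hball _ h3).2, inv_mul_cancel₀ (hball _ h4).2, sub_self] at this
    exact this
  filter_upwards [Metric.ball_mem_nhds t0 hη] with t ht
  have hconst : F (f t) - F (g t) = F (f t0) - F (g t0) :=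
    (convex_ball t0 η).is_const_of_fderivWithin_eq_zero (𝕜 := ℝ)
      (fun x hx => (hD x hx).differentiableAt.differentiableWithinAt)
      (fun x hx => by
        rw [fderivWithin_of_isOpen Metric.isOpen_ball hx]
        ext
        simp [(hD x hx).deriv]) ht (Metric.mem_ball_self hη)
  rw [hfg, sub_self, sub_eq_zero] at hconst
  obtain ⟨-, h3, h4⟩ := hall t ht
  rcases lt_trichotomy (f t) (g t) with h | h | h
  · exact absurd hconst (hinj _ h3 _ h4 h)
  · exact h
  · exact absurd hconst.symm (hinj _ h4 _ h3 h)

/-- Solutions of the autonomous equation are preserved by translations and reflections. -/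
lemma IsSolAuto.comp_affine {p aa : ℝ} {W v v' : ℝ → ℝ} (h : IsSolAuto p aa W v v')
    {σ : ℝ} (hσ : σ = 1 ∨ σ = -1) (t : ℝ) :
    IsSolAuto p aa W (fun y => v (σ * y + t)) (fun y => σ * v' (σ * y + t)) := by
  obtain ⟨hc, hd, g, hg, hgd, hge⟩ := h
  have haff : ∀ x, HasDerivAt (fun y : ℝ => σ * y + t) σ x := fun x => by
    simpa using ((hasDerivAt_id x).const_mul σ).add_const t
  refine ⟨by fun_prop, fun x => ?_, fun y => g (σ * y + t), by fun_prop, fun x => ?_,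
    fun x => hge _⟩
  · have := (hd (σ * x + t)).comp x (haff x)
    rwa [mul_comm] at this
  · have := (hgd (σ * x + t)).comp x (haff x)
    rcases hσ with rfl | rfl
    · simpa [Function.comp_def] using this
    · simpa [Function.comp_def, phip_neg] using this.fun_neg

lemma Lfun_sign_mul {p σ : ℝ} (hσ : σ = 1 ∨ σ = -1) (s : ℝ) : Lfun p (σ * s) = Lfun p s := by
  rcases hσ with rfl | rfl
  · simp
  · simp [Lfun_neg]

/-- Local uniqueness for the autonomous equation at a fixed energy level, at a point which is not
an equilibrium. -/
lemma IsSolAuto.eventuallyEq {p aa e : ℝ} (hp : 1 < p) (ha : 0 < aa) {W : ℝ → ℝ}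
    (hW : ContDiff ℝ 1 W) {v v' z z' : ℝ → ℝ} (hv : IsSolAuto p aa W v v')
    (hz : IsSolAuto p aa W z z')
    (hve : ∀ y, -(1 / aa) * Lfun p (v' y) + W (v y) = e)
    (hze : ∀ y, -(1 / aa) * Lfun p (z' y) + W (z y) = e)
    {t : ℝ} (hreg : v' t ≠ 0 ∨ deriv W (v t) ≠ 0) (h0 : v t = z t) (h0' : v' t = z' t) :
    v =ᶠ[𝓝 t] z := by
  obtain ⟨hvc, hvd, gv, hgv, hgvd, hgve⟩ := hv
  obtain ⟨hzc, hzd, gz, hgz, hgzd, hgze⟩ := hz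
  have hWc := hW.continuous
  have hWd : Continuous (deriv W) := hW.continuous_deriv le_rfl
  by_cases hvt : v' t = 0
  · have hW' : deriv W (v t) ≠ 0 := hreg.resolve_left (not_not.2 hvt)
    have hstrict : HasStrictDerivAt W (deriv W (v t)) (v t) :=
      (hW.contDiffAt.hasStrictDerivAt (by norm_num))
    set P := (hstrict.hasStrictFDerivAt_equiv hW').toOpenPartialHomeomorph W with hP
    have hPs : v t ∈ P.source :=
      (hstrict.hasStrictFDerivAt_equiv hW').mem_toOpenPartialHomeomorph_source
    have hPt : W (v t) ∈ P.target :=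
      (hstrict.hasStrictFDerivAt_equiv hW').image_mem_toOpenPartialHomeomorph_target
    have hPl : ∀ x ∈ P.source, P.symm (W x) = x := fun x hx => P.left_inv hx
    set q := p / (p - 1) with hq
    have hq0 : 0 < q := by have := one_lt_conj hp; linarith
    let Q : ℝ → ℝ := fun w => e + 1 / aa * (|w| ^ q / q)
    have hQc : Continuous Q := by
      have : Continuous (fun w : ℝ => |w| ^ q) :=
        continuous_abs.rpow_const (fun _ => Or.inr hq0.le)
      fun_prop
    have hQ : ∀ {x x' : ℝ → ℝ}, (∀ y, -(1 / aa) * Lfun p (x' y) + W (x y) = e) →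
        ∀ y, Q (phip p (x' y)) = W (x y) := by
      intro x x' hx y
      have := hx y
      simp only [Q]
      rw [hq, ← abs_rpow_eq_abs_phip hp]
      simp only [Lfun] at this
      linarith
    have hw0 : Q (phip p (v' t)) ∈ P.target := by rw [hQ hve]; exact hPt
    have hH := eventuallyEq_of_autonomous (t0 := t)
      (H := fun w => aa * deriv W (P.symm (Q w)))
      (f := fun y => phip p (v' y)) (g := fun y => phip p (z' y))
      (by
        filter_upwards [hQc.continuousAt.eventually_mem (P.open_target.mem_nhds hw0)] with w hw
        exact continuousAt_const.mul (hWd.continuousAt.comp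
          ((P.continuousAt_symm hw).comp hQc.continuousAt)))
      (by
        simp only [hQ hve]
        rw [hPl _ hPs]
        exact mul_ne_zero ha.ne' hW')
      (by
        filter_upwards [(hvd t).continuousAt.eventually_mem (P.open_source.mem_nhds hPs)] with y hy
        rw [hQ hve, hPl _ hy, ← hgve]
        exact hgvd y)
      (by
        rw [h0] at hPs
        filter_upwards [(hzd t).continuousAt.eventually_mem (P.open_source.mem_nhds hPs)] with y hy
        rw [hQ hze, hPl _ hy, ← hgze]
        exact hgzd y)
      (by simp only [h0'])
    have hPs' := hPs
    rw [h0] at hPs'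
    filter_upwards [hH, (hvd t).continuousAt.eventually_mem (P.open_source.mem_nhds hPs),
      (hzd t).continuousAt.eventually_mem (P.open_source.mem_nhds hPs')] with y h1 h2 h3
    rw [← hPl _ h2, ← hPl _ h3, ← hQ hve, ← hQ hze]
    rw [h1]
  · let σ : ℝ := SignType.sign (v' t)
    have hσ0 : σ ≠ 0 := by
      simp only [σ]
      rcases lt_or_gt_of_ne hvt with h | h
      · simp [sign_neg h]
      · simp [sign_pos h]
    let H : ℝ → ℝ := fun s => σ * (p / (p - 1) * (aa * (W s - e))) ^ (1 / p)
    have hHc : Continuous H := by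
      have : Continuous (fun s : ℝ => (p / (p - 1) * (aa * (W s - e))) ^ (1 / p)) :=
        Continuous.rpow_const (by fun_prop) (fun _ => Or.inr (by positivity))
      fun_prop
    have key : ∀ {x x' : ℝ → ℝ}, (∀ y, -(1 / aa) * Lfun p (x' y) + W (x y) = e) →
        Continuous x' → x' t = v' t → ∀ᶠ y in 𝓝 t, x' y = H (x y) := by
      intro x x' hx hxc hxt
      have hs : ∀ᶠ y in 𝓝 t, (SignType.sign (x' y) : ℝ) = σ := by
        rcases lt_or_gt_of_ne hvt with h | h
        · filter_upwards [hxc.continuousAt.eventually_lt_const (hxt.trans_lt h)] with y hy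
          simp [σ, sign_neg h, sign_neg hy]
        · filter_upwards [hxc.continuousAt.eventually_const_lt (h.trans_eq hxt.symm)] with y hy
          simp [σ, sign_pos h, sign_pos hy]
      filter_upwards [hs] with y hy
      simp only [H]
      rw [← Lfun_eq_of_energy ha (hx y), ← abs_eq_of_Lfun hp, ← hy, sign_mul_abs]
    refine eventuallyEq_of_autonomous (H := H) (Eventually.of_forall fun x => hHc.continuousAt) ?_
      ?_ ?_ h0
    · rw [← (key hve hvc rfl).self_of_nhds]; exact hvt
    · filter_upwards [key hve hvc rfl] with y hy
      rw [← hy]; exact hvd y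
    · filter_upwards [key hze hzc h0'.symm] with y hy
      rw [← hy]; exact hzd y

/-- Global uniqueness at a fixed energy level for solutions avoiding equilibria. -/
lemma IsSolAuto.eq_of_initial {p aa e : ℝ} (hp : 1 < p) (ha : 0 < aa) {W : ℝ → ℝ}
    (hW : ContDiff ℝ 1 W) {v v' z z' : ℝ → ℝ} (hv : IsSolAuto p aa W v v')
    (hz : IsSolAuto p aa W z z')
    (hve : ∀ y, -(1 / aa) * Lfun p (v' y) + W (v y) = e)
    (hze : ∀ y, -(1 / aa) * Lfun p (z' y) + W (z y) = e)
    (hreg : ∀ t, v' t ≠ 0 ∨ deriv W (v t) ≠ 0) {t : ℝ} (h0 : v t = z t) (h0' : v' t = z' t) :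
    v = z := by
  have hclopen : IsClopen {y | v y = z y ∧ v' y = z' y} := by
    have hvc : Continuous v := continuous_iff_continuousAt.2 fun x => (hv.2.1 x).continuousAt
    have hzc : Continuous z := continuous_iff_continuousAt.2 fun x => (hz.2.1 x).continuousAt
    refine ⟨(isClosed_eq hvc hzc).inter (isClosed_eq hv.1 hz.1), isOpen_iff_mem_nhds.2 ?_⟩
    rintro y ⟨h1, h2⟩
    have hev := hv.eventuallyEq hp ha hW hz hve hze (hreg y) h1 h2
    filter_upwards [hev.eventually_nhds] with x hx
    refine ⟨hx.self_of_nhds, ?_⟩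
    exact (hv.2.1 x).unique ((hz.2.1 x).congr_of_eventuallyEq hx)
  have huniv := hclopen.eq_univ ⟨t, h0, h0'⟩
  funext y
  have : y ∈ {y | v y = z y ∧ v' y = z' y} := huniv ▸ mem_univ y
  exact this.1

/-- Growth and criticality of the potential at a well `m`. -/
lemma well_facts {p C m : ℝ} (hp : 1 < p) {W : ℝ → ℝ} (hW : ContDiff ℝ 1 W)
    (hm : m ∈ Icc (-1:ℝ) 1)
    (h : (fun u => W u - C / p * |u - m| ^ p) =o[𝓝[Icc (-1:ℝ) 1] m] (fun u => |u - m| ^ p)) :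
    W m = 0 ∧ deriv W m = 0 ∧ ∃ K, 0 < K ∧ ∀ᶠ u in 𝓝[Icc (-1:ℝ) 1] m, |W u| ≤ K * |u - m| ^ p := by
  have hO : W =O[𝓝[Icc (-1:ℝ) 1] m] (fun u => |u - m| ^ p) := by
    have := h.isBigO.add (isBigO_const_mul_self (C / p) (fun u => |u - m| ^ p) _)
    simpa using this
  obtain ⟨K, hK, hb⟩ := hO.exists_pos
  have hb' : ∀ᶠ u in 𝓝[Icc (-1:ℝ) 1] m, |W u| ≤ K * |u - m| ^ p := by
    filter_upwards [hb.bound] with u hu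
    simpa [abs_of_nonneg (Real.rpow_nonneg (abs_nonneg (u - m)) p)] using hu
  have hm0 : W m = 0 := by
    have := hb'.self_of_nhdsWithin hm
    simpa [Real.zero_rpow (show p ≠ 0 by linarith)] using this
  refine ⟨hm0, ?_, K, hK, hb'⟩
  have hlo : (fun u => |u - m| ^ p) =o[𝓝[Icc (-1:ℝ) 1] m] (fun u => u - m) := by
    have h1 : (fun u => |u - m| ^ p) = fun u => |u - m| ^ (p - 1) * |u - m| := by
      funext u
      rcases eq_or_ne (|u - m|) 0 with h0 | h0
      · simp [h0, Real.zero_rpow (show p ≠ 0 by linarith)]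
      · nth_rewrite 3 [← Real.rpow_one |u - m|]
        rw [← Real.rpow_add (lt_of_le_of_ne (abs_nonneg _) h0.symm)]
        ring_nf
    have h2 : Tendsto (fun u => |u - m| ^ (p - 1)) (𝓝[Icc (-1:ℝ) 1] m) (𝓝 0) := by
      have : Continuous (fun u : ℝ => |u - m| ^ (p - 1)) :=
        Continuous.rpow_const (by fun_prop) (fun _ => Or.inr (by linarith))
      have := this.tendsto m
      rw [sub_self, abs_zero, Real.zero_rpow (by linarith)] at this
      exact this.mono_left nhdsWithin_le_nhds
    rw [h1]
    have h3 := ((isLittleO_one_iff ℝ).2 h2).mul_isBigO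
      (isBigO_refl (fun u => |u - m|) (𝓝[Icc (-1:ℝ) 1] m))
    simpa using h3
  have hder : HasDerivWithinAt W 0 (Icc (-1:ℝ) 1) m := by
    rw [hasDerivWithinAt_iff_isLittleO]
    simpa [hm0] using hO.trans_isLittleO hlo
  have hder' := (hW.differentiable (by norm_num) m).hasDerivAt.hasDerivWithinAt
    (s := Icc (-1:ℝ) 1)
  exact (uniqueDiffOn_Icc (show (-1:ℝ) < 1 by norm_num) m hm).eq_deriv _ hder' hder

/-- The shape of a double-well potential on `[-1, 1]`. -/
structure DoubleWell (p : ℝ) (W : ℝ → ℝ) (W0 : ℝ) : Prop where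
  smooth : ContDiff ℝ 1 W
  one : W 1 = 0
  neg_one : W (-1) = 0
  zero : W 0 = W0
  deriv_neg : ∀ u ∈ Ioo (0:ℝ) 1, deriv W u < 0
  deriv_pos : ∀ u ∈ Ioo (-1:ℝ) 0, 0 < deriv W u
  growth : ∀ m : ℝ, m = 1 ∨ m = -1 →
    ∃ K, 0 < K ∧ ∀ᶠ u in 𝓝[Icc (-1:ℝ) 1] m, |W u| ≤ K * |u - m| ^ p

lemma doubleWell_of_conditions {p : ℝ} (hp : 1 < p) {W : ℝ → ℝ} (hW : ContDiff ℝ 1 W)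
    {Cm1 C0 C1 W0 : ℝ} (hW1 : W1cond p W Cm1 C0 C1 W0) (hW2 : W2cond p W) :
    DoubleWell p W W0 := by
  obtain ⟨-, -, -, -, h1, h2, h3⟩ := hW1
  have h2' : (fun u => W u - Cm1 / p * |u - (-1)| ^ p) =o[𝓝[Icc (-1:ℝ) 1] (-1)]
      (fun u => |u - (-1)| ^ p) := by simpa using h2
  obtain ⟨a1, a2, a3⟩ := well_facts hp hW (by norm_num) h1
  obtain ⟨b1, b2, b3⟩ := well_facts hp hW (by norm_num) h2'
  refine ⟨hW, a1, b1, ?_, fun u hu => ?_, fun u hu => ?_, ?_⟩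
  · have := (h3.bound (show (0:ℝ) < 1 by norm_num)).self_of_nhdsWithin (by norm_num)
    simp only [abs_zero, Real.zero_rpow (show p ≠ 0 by linarith)] at this
    simpa [sub_eq_zero] using this
  · have := hW2.2 (show u ∈ Ioc (0:ℝ) 1 from ⟨hu.1, hu.2.le⟩) (by norm_num) hu.2
    simp only [a2, zero_div] at this
    have hpos := phip_pos (p := p) hu.1
    rcases div_neg_iff.1 this with h | h
    · linarith [h.2]
    · exact h.1
  · have := hW2.1 (show (-1:ℝ) ∈ Ico (-1:ℝ) 0 by norm_num) ⟨hu.1.le, hu.2⟩ hu.1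
    simp only [b2, zero_div] at this
    have hneg := phip_lt_zero (p := p) hu.2
    rcases div_neg_iff.1 this with h | h
    · exact h.1
    · linarith [h.2]
  · rintro m (rfl | rfl)
    · exact a3
    · exact b3

namespace DoubleWell

variable {p : ℝ} {W : ℝ → ℝ} {W0 : ℝ}

lemma strictAntiOn (h : DoubleWell p W W0) : StrictAntiOn W (Icc 0 1) :=
  strictAntiOn_of_deriv_neg (convex_Icc 0 1) h.smooth.continuous.continuousOn
    (by simpa using h.deriv_neg)

lemma strictMonoOn (h : DoubleWell p W W0) : StrictMonoOn W (Icc (-1) 0) :=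
  strictMonoOn_of_deriv_pos (convex_Icc (-1) 0) h.smooth.continuous.continuousOn
    (by simpa using h.deriv_pos)

lemma lt_top (h : DoubleWell p W W0) {u : ℝ} (hu : u ∈ Icc (-1:ℝ) 1) (h0 : u ≠ 0) :
    W u < W0 := by
  rw [← h.zero]
  rcases lt_or_gt_of_ne h0 with h0 | h0
  · exact h.strictMonoOn ⟨hu.1, h0.le⟩ (by norm_num) h0
  · exact h.strictAntiOn (by norm_num) ⟨h0.le, hu.2⟩ h0

lemma le_top (h : DoubleWell p W W0) {u : ℝ} (hu : u ∈ Icc (-1:ℝ) 1) : W u ≤ W0 := by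
  rcases eq_or_ne u 0 with rfl | h0
  · exact h.zero.le
  · exact (h.lt_top hu h0).le

lemma pos (h : DoubleWell p W W0) {u : ℝ} (hu : u ∈ Ioo (-1:ℝ) 1) : 0 < W u := by
  rcases le_total u 0 with h0 | h0
  · rw [← h.neg_one]
    exact h.strictMonoOn (by norm_num) ⟨hu.1.le, h0⟩ hu.1
  · rw [← h.one]
    exact h.strictAntiOn ⟨h0, hu.2.le⟩ (by norm_num) hu.2

lemma nonneg (h : DoubleWell p W W0) {u : ℝ} (hu : u ∈ Icc (-1:ℝ) 1) : 0 ≤ W u := by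
  rcases eq_or_lt_of_le hu.1 with rfl | h1
  · exact h.neg_one.ge
  rcases eq_or_lt_of_le hu.2 with rfl | h2
  · exact h.one.ge
  exact (h.pos ⟨h1, h2⟩).le

lemma deriv_ne_zero (h : DoubleWell p W W0) {u : ℝ} (hu : u ∈ Ioo (-1:ℝ) 1) (h0 : u ≠ 0) :
    deriv W u ≠ 0 := by
  rcases lt_or_gt_of_ne h0 with h0 | h0
  · exact (h.deriv_pos u ⟨hu.1, h0⟩).ne'
  · exact (h.deriv_neg u ⟨h0, hu.2⟩).ne

end DoubleWell

lemma pos_or_neg_of_continuous_ne_zero {f : ℝ → ℝ} (hf : Continuous f) (h : ∀ x, f x ≠ 0) :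
    (∀ x, 0 < f x) ∨ ∀ x, f x < 0 := by
  by_contra! hcon
  obtain ⟨⟨x, hx⟩, y, hy⟩ := hcon
  obtain ⟨z, hz⟩ := mem_range_of_exists_le_of_exists_ge hf ⟨x, hx⟩ ⟨y, hy⟩
  exact h z hz

lemma add_mul_le_of_le_deriv {v v' : ℝ → ℝ} (hd : ∀ x, HasDerivAt v (v' x) x) {c t y : ℝ}
    (hc : ∀ x, t ≤ x → c ≤ v' x) (hy : t ≤ y) : v t + c * (y - t) ≤ v y := by
  have := (convex_Ici t).mul_sub_le_image_sub_of_le_deriv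
    (fun x _ => (hd x).continuousAt.continuousWithinAt)
    (fun x _ => (hd x).differentiableAt.differentiableWithinAt) (C := c)
    (fun x hx => by
      rw [(hd x).deriv]
      rw [interior_Ici] at hx
      exact hc x hx.le) t self_mem_Ici y hy hy
  linarith

/-- A function with derivative bounded below by a positive constant on a half-line is unbounded. -/
lemma not_bounded_of_le_deriv {v v' : ℝ → ℝ} (hd : ∀ x, HasDerivAt v (v' x) x) {B c t : ℝ}
    (hB : ∀ x, |v x| ≤ B) (hc0 : 0 < c) (hc : ∀ x, t ≤ x → c ≤ v' x) : False := by
  have hB0 : 0 ≤ B := (abs_nonneg _).trans (hB 0)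
  have h0 : 0 ≤ (2 * B + 1) / c := by positivity
  have h1 := add_mul_le_of_le_deriv hd hc (show t ≤ t + (2 * B + 1) / c by linarith)
  rw [add_sub_cancel_left, mul_div_cancel₀ _ hc0.ne'] at h1
  have h2 := abs_le.1 (hB t)
  have h3 := abs_le.1 (hB (t + (2 * B + 1) / c))
  linarith

lemma hasDerivAt_comp_neg {v v' : ℝ → ℝ} (hd : ∀ x, HasDerivAt v (v' x) x) (x : ℝ) :
    HasDerivAt (fun x => -v (-x)) (v' (-x)) x := by
  simpa [Function.comp_def] using ((hd (-x)).comp x (hasDerivAt_neg x)).fun_neg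

/-- A bounded function on the line cannot be strictly concave. -/
lemma not_bounded_of_strictAnti_deriv {v v' : ℝ → ℝ} (hd : ∀ x, HasDerivAt v (v' x) x) {B : ℝ}
    (hB : ∀ x, |v x| ≤ B) (hanti : StrictAnti v') : False := by
  have h01 : v' 1 < v' 0 := hanti (by norm_num)
  rcases lt_or_ge (v' 1) 0 with h | h
  · refine not_bounded_of_le_deriv (v := fun x => -v x) (v' := fun x => -v' x) (t := 1)
      (c := -v' 1) (fun x => (hd x).fun_neg) (B := B) (by simpa using hB) (by linarith)
      (fun x hx => neg_le_neg (hanti.antitone hx))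
  · refine not_bounded_of_le_deriv (v := fun x => -v (-x)) (v' := fun x => v' (-x)) (t := 0)
      (c := v' 0) (hasDerivAt_comp_neg hd) (B := B) (fun x => by simpa using hB (-x))
      (by linarith) (fun x hx => hanti.antitone (by linarith))

lemma IsSolAuto.continuous {p aa : ℝ} {W v v' : ℝ → ℝ} (h : IsSolAuto p aa W v v') :
    Continuous v :=
  continuous_iff_continuousAt.2 fun x => (h.2.1 x).continuousAt

/-- A solution lying strictly between the wells vanishes somewhere. -/
lemma IsSolAuto.exists_zero {p aa W0 : ℝ} (hp : 1 < p) (ha : 0 < aa) {W v v' : ℝ → ℝ}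
    (hW : DoubleWell p W W0) (h : IsSolAuto p aa W v v') (hv : ∀ x, v x ∈ Ioo (-1:ℝ) 1) :
    ∃ t, v t = 0 := by
  by_contra! hne
  have hB : ∀ x, |v x| ≤ 1 := fun x => abs_le.2 ⟨(hv x).1.le, (hv x).2.le⟩
  have hc := h.continuous
  obtain ⟨-, hd, g, -, hgd, hge⟩ := h
  rcases pos_or_neg_of_continuous_ne_zero hc hne with hs | hs
  · have hanti : StrictAnti (fun y => phip p (v' y)) :=
      strictAnti_of_hasDerivAt_neg hgd fun x => by
        rw [hge]; exact mul_neg_of_pos_of_neg ha (hW.deriv_neg _ ⟨hs x, (hv x).2⟩)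
    exact not_bounded_of_strictAnti_deriv hd hB
      fun x y hxy => (phip_strictMono hp).lt_iff_lt.1 (hanti hxy)
  · have hmono : StrictMono (fun y => phip p (v' y)) :=
      strictMono_of_hasDerivAt_pos hgd fun x => by
        rw [hge]; exact mul_pos ha (hW.deriv_pos _ ⟨(hv x).1, hs x⟩)
    exact not_bounded_of_strictAnti_deriv (v := fun x => -v x) (v' := fun x => -v' x)
      (fun x => (hd x).fun_neg) (B := 1) (by simpa using hB)
      fun x y hxy => neg_lt_neg ((phip_strictMono hp).lt_iff_lt.1 (hmono hxy))

/-- A zero-energy solution starting strictly between the wells does not reach them in the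
future. -/
lemma mem_Ioo_of_zero_energy_of_le {p aa W0 : ℝ} (hp : 1 < p) (ha : 0 < aa) {W v v' : ℝ → ℝ}
    (hW : DoubleWell p W W0) (hd : ∀ x, HasDerivAt v (v' x) x)
    (he : ∀ y, -(1 / aa) * Lfun p (v' y) + W (v y) = 0) {t1 t2 : ℝ} (h12 : t1 ≤ t2)
    (h1 : v t1 ∈ Ioo (-1:ℝ) 1) : v t2 ∈ Ioo (-1:ℝ) 1 := by
  by_contra h2
  have hc : Continuous v := continuous_iff_continuousAt.2 fun x => (hd x).continuousAt
  have hcomp : IsCompact (Icc t1 t2 ∩ v ⁻¹' (Ioo (-1:ℝ) 1)ᶜ) :=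
    isCompact_Icc.inter_right ((isOpen_Ioo.isClosed_compl).preimage hc)
  obtain ⟨s, ⟨hs12, hs⟩, hleast⟩ := hcomp.exists_isLeast ⟨t2, ⟨h12, le_rfl⟩, h2⟩
  have hbefore : ∀ r ∈ Ico t1 s, v r ∈ Ioo (-1:ℝ) 1 := by
    intro r hr
    by_contra hr2
    exact absurd (hleast ⟨⟨hr.1, hr.2.le.trans hs12.2⟩, hr2⟩) (not_le.2 hr.2)
  have ht1s : t1 < s := by
    rcases eq_or_lt_of_le hs12.1 with h | h
    · exact absurd h1 (h ▸ hs)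
    · exact h
  have hsIcc : v s ∈ Icc (-1:ℝ) 1 := by
    have hcl : s ∈ closure (Ico t1 s) := by
      rw [closure_Ico ht1s.ne]; exact ⟨ht1s.le, le_rfl⟩
    have := map_mem_closure hc hcl (t := Icc (-1:ℝ) 1)
      (fun r hr => Ioo_subset_Icc_self (hbefore r hr))
    rwa [isClosed_Icc.closure_eq] at this
  have hm : v s = 1 ∨ v s = -1 := by
    by_contra! hcon
    exact hs ⟨lt_of_le_of_ne hsIcc.1 hcon.2.symm, lt_of_le_of_ne hsIcc.2 hcon.1⟩
  obtain ⟨K, hK, hgrow⟩ := hW.growth _ hm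
  rw [eventually_nhdsWithin_iff] at hgrow
  obtain ⟨δ, hδ, hball⟩ := Metric.eventually_nhds_iff_ball.1 (hc.continuousAt.eventually hgrow)
  set η := min (δ / 2) (s - t1) with hη
  have hη0 : 0 < η := lt_min (by linarith) (by linarith)
  have hηδ : η < δ := (min_le_left _ _).trans_lt (by linarith)
  have hηt : η ≤ s - t1 := min_le_right _ _
  set q := p / (p - 1) with hq
  have hq0 : 0 < q := by have := one_lt_conj hp; linarith
  have hbound : ∀ x ∈ Ico (0:ℝ) η,
      ‖-v' (s - x)‖ ≤ (q * (aa * K)) ^ (1 / p) * ‖v (s - x) - v s‖ := by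
    intro x hx
    have hmem : v (s - x) ∈ Icc (-1:ℝ) 1 := by
      rcases eq_or_lt_of_le hx.1 with h | h
      · rw [← h, sub_zero]; exact hsIcc
      · exact Ioo_subset_Icc_self (hbefore _ ⟨by linarith [hx.2], by linarith⟩)
    have hg := hball (s - x) (by
      rw [Metric.mem_ball, Real.dist_eq, abs_lt]; constructor <;> linarith [hx.1, hx.2]) hmem
    have hL := Lfun_eq_of_energy ha (he (s - x))
    rw [sub_zero] at hL
    rw [norm_neg, Real.norm_eq_abs, Real.norm_eq_abs, abs_eq_of_Lfun hp, hL]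
    have hW0 := hW.nonneg hmem
    calc (q * (aa * W (v (s - x)))) ^ (1 / p)
        ≤ (q * (aa * K) * |v (s - x) - v s| ^ p) ^ (1 / p) := by
          apply Real.rpow_le_rpow (by positivity) _ (by positivity)
          rw [abs_of_nonneg hW0] at hg
          calc q * (aa * W (v (s - x))) ≤ q * (aa * (K * |v (s - x) - v s| ^ p)) := by gcongr
            _ = _ := by ring
      _ = (q * (aa * K)) ^ (1 / p) * |v (s - x) - v s| := by
          rw [Real.mul_rpow (by positivity) (by positivity), ← Real.rpow_mul (abs_nonneg _),
            mul_one_div_cancel (by linarith), Real.rpow_one]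
  have hzero := eq_zero_of_abs_deriv_le_mul_abs_self_of_eq_zero_right
    (f := fun x => v (s - x) - v s) (f' := fun x => -v' (s - x)) (a := 0) (b := η)
    (by fun_prop)
    (fun x _ => by
      have := ((hd (s - x)).comp x ((hasDerivAt_id x).const_sub s)).sub_const (v s)
      simpa [Function.comp_def] using this.hasDerivWithinAt)
    (by simp) hbound η ⟨hη0.le, le_rfl⟩
  have hmem := hbefore (s - η) ⟨by linarith, by linarith⟩
  rw [sub_eq_zero.1 hzero] at hmem
  exact hs hmem

/-- A zero-energy solution starting strictly between the wells never reaches them. -/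
lemma IsSolAuto.mem_Ioo_of_zero_energy {p aa W0 : ℝ} (hp : 1 < p) (ha : 0 < aa)
    {W v v' : ℝ → ℝ} (hW : DoubleWell p W W0) (h : IsSolAuto p aa W v v')
    (he : ∀ y, -(1 / aa) * Lfun p (v' y) + W (v y) = 0) {t1 : ℝ}
    (h1 : v t1 ∈ Ioo (-1:ℝ) 1) (t2 : ℝ) : v t2 ∈ Ioo (-1:ℝ) 1 := by
  rcases le_total t1 t2 with h12 | h12
  · exact mem_Ioo_of_zero_energy_of_le hp ha hW h.2.1 he h12 h1
  · have := mem_Ioo_of_zero_energy_of_le hp ha hW (h.comp_affine (Or.inr rfl) 0).2.1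
      (fun y => by rw [Lfun_sign_mul (Or.inr rfl)]; exact he _) (t1 := -t1) (t2 := -t2)
      (by linarith) (by simpa using h1)
    simpa using this

/-- Two solutions with the same energy, vanishing somewhere, agree up to translation and
reflection. -/
lemma IsSolAuto.eq_or_eq_reflection {p aa e : ℝ} (hp : 1 < p) (ha : 0 < aa) {W : ℝ → ℝ}
    (hW : ContDiff ℝ 1 W) {v v' z z' : ℝ → ℝ} (hv : IsSolAuto p aa W v v')
    (hz : IsSolAuto p aa W z z')
    (hve : ∀ y, -(1 / aa) * Lfun p (v' y) + W (v y) = e)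
    (hze : ∀ y, -(1 / aa) * Lfun p (z' y) + W (z y) = e)
    (hreg : ∀ t, z' t ≠ 0 ∨ deriv W (z t) ≠ 0) (hz0 : z 0 = 0) {t : ℝ} (hvt : v t = 0) :
    (∀ y, v y = z (y + -t)) ∨ ∀ y, v y = z (-y + t) := by
  have habs : |z' 0| = |v' t| := by
    rw [abs_eq_of_Lfun hp (z' 0), abs_eq_of_Lfun hp (v' t), Lfun_eq_of_energy ha (hve t),
      Lfun_eq_of_energy ha (hze 0), hvt, hz0]
  have key : ∀ σ : ℝ, σ = 1 ∨ σ = -1 → z' 0 = σ * v' t → ∀ y, z y = v (σ * y + t) := by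
    intro σ hσ h0 y
    have := hz.eq_of_initial hp ha hW (hv.comp_affine hσ t) hze
      (fun y => by rw [Lfun_sign_mul hσ]; exact hve _) hreg (t := 0) (by simp [hz0, hvt])
      (by simpa using h0)
    exact congrFun this y
  rcases abs_eq_abs.1 habs with h | h
  · left
    intro y
    rw [key 1 (Or.inl rfl) (by simpa using h)]
    congr 1; ring
  · right
    intro y
    rw [key (-1) (Or.inr rfl) (by simpa using h)]
    congr 1; ring

/-- The energy of a bounded solution between the wells lies between the extreme values of the
potential. -/
lemma IsSolAuto.energy_mem_Icc {p aa e W0 : ℝ} (hp : 1 < p) (ha : 0 < aa) {W v v' : ℝ → ℝ}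
    (hW : DoubleWell p W W0) (h : IsSolAuto p aa W v v') (hv : ∀ x, v x ∈ Icc (-1:ℝ) 1)
    (he : ∀ y, -(1 / aa) * Lfun p (v' y) + W (v y) = e) : e ∈ Icc 0 W0 := by
  refine ⟨?_, (le_of_energy hp ha (he 0)).trans (hW.le_top (hv 0))⟩
  by_contra! hneg
  have hB : ∀ x, |v x| ≤ 1 := fun x => abs_le.2 (hv x)
  have hq0 : 0 < p / (p - 1) := by have := one_lt_conj hp; linarith
  have hne0 : 0 < -e := by linarith
  have hc0 : 0 < (p / (p - 1) * (aa * -e)) ^ (1 / p) := by positivity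
  have hlow : ∀ x, (p / (p - 1) * (aa * -e)) ^ (1 / p) ≤ |v' x| := by
    intro x
    rw [abs_eq_of_Lfun hp (v' x), Lfun_eq_of_energy ha (he x)]
    have := hW.nonneg (hv x)
    gcongr
    linarith
  have hne : ∀ x, v' x ≠ 0 := fun x => abs_pos.1 (hc0.trans_le (hlow x))
  rcases pos_or_neg_of_continuous_ne_zero h.1 hne with hs | hs
  · exact not_bounded_of_le_deriv h.2.1 hB hc0 (t := 0)
      fun x _ => by simpa [abs_of_pos (hs x)] using hlow x
  · exact not_bounded_of_le_deriv (v := fun x => -v x) (v' := fun x => -v' x)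
      (fun x => (h.2.1 x).fun_neg) (B := 1) (by simpa using hB) hc0 (t := 0)
      fun x _ => by simpa [abs_of_neg (hs x)] using hlow x

/-- Solutions with energy strictly between the extreme values of the potential stay strictly
between the wells. -/
lemma IsSolAuto.mem_Ioo_of_pos_energy {p aa e W0 : ℝ} (hp : 1 < p) (ha : 0 < aa)
    {W v v' : ℝ → ℝ} (hW : DoubleWell p W W0) (h : IsSolAuto p aa W v v')
    (he : ∀ y, -(1 / aa) * Lfun p (v' y) + W (v y) = e) (he0 : 0 < e) {t : ℝ}
    (ht : v t ∈ Icc (-1:ℝ) 1) (x : ℝ) : v x ∈ Ioo (-1:ℝ) 1 := by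
  have hc := h.continuous
  have hWe : ∀ x, e ≤ W (v x) := fun x => le_of_energy hp ha (he x)
  have h1 : ∀ x, 1 - v x ≠ 0 := fun x hx => by
    have := hWe x
    rw [← sub_eq_zero.1 hx, hW.one] at this
    linarith
  have h2 : ∀ x, v x + 1 ≠ 0 := fun x hx => by
    have := hWe x
    rw [eq_neg_of_add_eq_zero_left hx, hW.neg_one] at this
    linarith
  constructor
  · rcases pos_or_neg_of_continuous_ne_zero (by fun_prop) h2 with hs | hs
    · linarith [hs x]
    · linarith [hs t, ht.1]
  · rcases pos_or_neg_of_continuous_ne_zero (by fun_prop) h1 with hs | hs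
    · linarith [hs x]
    · linarith [hs t, ht.2]

lemma IsSolAuto.eq_periodic_translate {p aa e W0 : ℝ} (hp : 1 < p) (ha : 0 < aa)
    {W v v' z z' : ℝ → ℝ} (hW : DoubleWell p W W0) (hv : IsSolAuto p aa W v v')
    (hz : IsSolAuto p aa W z z') (hrange : ∀ x, v x ∈ Icc (-1:ℝ) 1)
    (hve : ∀ y, -(1 / aa) * Lfun p (v' y) + W (v y) = e)
    (hze : ∀ y, -(1 / aa) * Lfun p (z' y) + W (z y) = e) (he : e ∈ Ioo 0 W0)
    (hz0 : z 0 = 0) {c : ℝ} (hc0 : 0 < c) (hc : Function.Periodic z c) :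
    ∃ t0, ∀ y, v y = z (y + t0) := by
  have hvI := hv.mem_Ioo_of_pos_energy hp ha hW hve he.1 (hrange 0)
  have hzI := hz.mem_Ioo_of_pos_energy hp ha hW hze he.1 (t := 0) (by simp [hz0])
  have hreg : ∀ t, z' t ≠ 0 ∨ deriv W (z t) ≠ 0 := by
    intro t
    by_cases h : z' t = 0
    · right
      refine hW.deriv_ne_zero (hzI t) fun h0 => ?_
      have := (eq_zero_iff_of_energy hp ha (hze t)).1 h
      rw [h0, hW.zero] at this
      exact he.2.ne' this
    · exact Or.inl h
  obtain ⟨t1, ht1⟩ := hv.exists_zero hp ha hW hvI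
  rcases hv.eq_or_eq_reflection hp ha hW.smooth hz hve hze hreg hz0 ht1 with h | h
  · exact ⟨_, h⟩
  · obtain ⟨m, -, hm⟩ := exists_hasDerivAt_eq_zero hc0 hz.continuous.continuousOn
      (by simpa using (hc 0).symm) (fun x _ => hz.2.1 x)
    have hsymm := hz.eq_of_initial hp ha hW.smooth (hz.comp_affine (Or.inr rfl) (2 * m)) hze
      (fun y => by rw [Lfun_sign_mul (Or.inr rfl)]; exact hze _) hreg (t := m)
      (by congr 1; ring) (by rw [show -1 * m + 2 * m = m by ring, hm]; simp)
    refine ⟨2 * m - t1, fun y => ?_⟩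
    rw [h, congrFun hsymm (-y + t1)]
    congr 1; ring

lemma IsSolAuto.zero_energy_classification {p aa W0 : ℝ} (hp : 1 < p) (ha : 0 < aa)
    {W v v' z z' : ℝ → ℝ} (hW : DoubleWell p W W0) (hv : IsSolAuto p aa W v v')
    (hz : IsSolAuto p aa W z z') (hrange : ∀ x, v x ∈ Icc (-1:ℝ) 1)
    (hve : ∀ y, -(1 / aa) * Lfun p (v' y) + W (v y) = 0)
    (hze : ∀ y, -(1 / aa) * Lfun p (z' y) + W (z y) = 0) (hz0 : z 0 = 0) :
    (∀ y, v y = 1) ∨ (∀ y, v y = -1) ∨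
      (∃ t0 : ℝ, (∀ y, v y = z (y + t0)) ∨ (∀ y, v y = z (-y + t0))) := by
  by_cases hex : ∃ t, v t ∈ Ioo (-1:ℝ) 1
  · obtain ⟨t, ht⟩ := hex
    have hvI := hv.mem_Ioo_of_zero_energy hp ha hW hve ht
    have hzI := hz.mem_Ioo_of_zero_energy hp ha hW hze (t1 := 0) (by simp [hz0])
    obtain ⟨t1, ht1⟩ := hv.exists_zero hp ha hW hvI
    have hreg : ∀ t, z' t ≠ 0 ∨ deriv W (z t) ≠ 0 := fun t => Or.inl fun h =>
      (hW.pos (hzI t)).ne' ((eq_zero_iff_of_energy hp ha (hze t)).1 h)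
    rcases hv.eq_or_eq_reflection hp ha hW.smooth hz hve hze hreg hz0 ht1 with h | h
    · exact Or.inr (Or.inr ⟨_, Or.inl h⟩)
    · exact Or.inr (Or.inr ⟨_, Or.inr h⟩)
  · have hpm : ∀ y, v y = 1 ∨ v y = -1 := by
      intro y
      by_contra! hcon
      exact hex ⟨y, lt_of_le_of_ne (hrange y).1 hcon.2.symm, lt_of_le_of_ne (hrange y).2 hcon.1⟩
    rcases pos_or_neg_of_continuous_ne_zero hv.continuous
      (fun y => by rcases hpm y with h | h <;> norm_num [h]) with hs | hs
    · exact Or.inl fun y => (hpm y).resolve_right fun h => by linarith [hs y]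
    · exact Or.inr (Or.inl fun y => (hpm y).resolve_left fun h => by linarith [hs y])

/-- Arzelà–Ascoli for uniformly bounded, uniformly Lipschitz functions on the line. -/
lemma exists_subseq_tendsto_of_lipschitz {f : ℕ → C(ℝ, ℝ)} {K : NNReal} {B : ℝ}
    (hK : ∀ n, LipschitzWith K (f n)) (hB : ∀ n x, |f n x| ≤ B) :
    ∃ g : C(ℝ, ℝ), ∃ φ : ℕ → ℕ, StrictMono φ ∧ Tendsto (f ∘ φ) atTop (𝓝 g) := by
  let S : Set C(ℝ, ℝ) := {h | LipschitzWith K h ∧ ∀ x, h x ∈ Icc (-B) B}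
  have himg : ContinuousMap.toFun '' S =
      {h : ℝ → ℝ | LipschitzWith K h} ∩ Set.pi univ (fun _ => Icc (-B) B) := by
    ext h
    constructor
    · rintro ⟨h, hh, rfl⟩
      exact ⟨hh.1, fun x _ => hh.2 x⟩
    · rintro ⟨h1, h2⟩
      exact ⟨⟨h, LipschitzWith.continuous h1⟩, ⟨h1, fun x => h2 x (mem_univ x)⟩, rfl⟩
  have hclosed : IsClosed {h : ℝ → ℝ | LipschitzWith K h} := by
    simp only [lipschitzWith_iff_dist_le_mul, ofPred_forall]
    refine isClosed_iInter fun x => isClosed_iInter fun y => ?_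
    exact isClosed_le (by fun_prop) continuous_const
  have hS : IsCompact S := by
    refine ArzelaAscoli.isCompact_of_equicontinuous S ?_ ?_
    · rw [himg]
      exact (isCompact_univ_pi fun _ => isCompact_Icc).inter_left hclosed
    · exact (LipschitzWith.uniformEquicontinuous (fun h : S => ⇑h.1) K
        fun h => h.2.1).equicontinuous
  obtain ⟨g, -, φ, hφ, hlim⟩ := hS.isSeqCompact (x := f)
    (fun n => ⟨hK n, fun x => abs_le.1 (hB n x)⟩)
  exact ⟨g, φ, hφ, hlim⟩

/-- Derivatives pass to locally uniform limits. -/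
lemma hasDerivAt_of_tendsto_continuousMap {f d : ℕ → C(ℝ, ℝ)} {g e : C(ℝ, ℝ)}
    (hf : Tendsto f atTop (𝓝 g)) (hd : Tendsto d atTop (𝓝 e))
    (h : ∀ R : ℝ, ∀ᶠ n in atTop, ∀ x ∈ Ioo (-R) R, HasDerivAt (f n) (d n x) x) (x : ℝ) :
    HasDerivAt g (e x) x := by
  have hx : x ∈ Ioo (-(|x| + 1)) (|x| + 1) := abs_lt.1 (by linarith)
  refine hasDerivAt_of_tendstoLocallyUniformlyOn isOpen_Ioo
    (ContinuousMap.tendsto_iff_tendstoLocallyUniformly.1 hd).tendstoLocallyUniformlyOn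
    (h _) (fun y _ => ?_) hx
  exact ((continuous_eval_const y).tendsto g).comp hf

/-- Uniform bound on the rescaled derivatives of solutions with uniformly convergent energies. -/
lemma exists_uniform_deriv_bound {p : ℝ} (hp : 1 < p) {a W : ℝ → ℝ} (hac : Continuous a)
    (hapos : ∀ x ∈ Icc (0:ℝ) 1, 0 < a x) (hWc : Continuous W) {εn : ℕ → ℝ} {u u' : ℕ → ℝ → ℝ}
    (hrange : ∀ n, ∀ x ∈ Icc (0:ℝ) 1, u n x ∈ Icc (-1:ℝ) 1) {E : ℝ → ℝ}
    (hconv : TendstoUniformlyOn (fun n x => Ener p (εn n) a W (u n) (u' n) x) E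
      atTop (Icc 0 1))
    (hEc : ContinuousOn E (Icc 0 1)) :
    ∃ N : ℕ, ∃ M : ℝ, 0 ≤ M ∧ ∀ n ≥ N, ∀ x ∈ Icc (0:ℝ) 1, |εn n * u' n x| ≤ M := by
  obtain ⟨B, hB⟩ := isCompact_Icc.exists_bound_of_continuousOn hEc
  obtain ⟨A, hA⟩ := (isCompact_Icc (a := (0:ℝ)) (b := 1)).exists_bound_of_continuousOn
    hac.continuousOn
  obtain ⟨D, hD⟩ := (isCompact_Icc (a := (-1:ℝ)) (b := 1)).exists_bound_of_continuousOn
    hWc.continuousOn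
  obtain ⟨N, hN⟩ := eventually_atTop.1 (Metric.tendstoUniformlyOn_iff.1 hconv 1 one_pos)
  have hq0 : 0 < p / (p - 1) := by have := one_lt_conj hp; linarith
  have h0 : (0:ℝ) ∈ Icc (0:ℝ) 1 := by norm_num
  have hA0 : 0 ≤ A := (norm_nonneg _).trans (hA 0 h0)
  have hB0 : 0 ≤ B := (norm_nonneg _).trans (hB 0 h0)
  have hD0 : 0 ≤ D := (norm_nonneg _).trans (hD 0 (by norm_num))
  refine ⟨N, (p / (p - 1) * (A * (D + (B + 1)))) ^ (1 / p), by positivity, fun n hn x hx => ?_⟩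
  have h1 := hN n hn x hx
  have h2 := Lfun_eq_of_energy (p := p) (hapos x hx)
    (rfl : -(1 / a x) * Lfun p (εn n * u' n x) + W (u n x) = _)
  change _ = a x * (W (u n x) - Ener p (εn n) a W (u n) (u' n) x) at h2
  have h3 := Lfun_nonneg hp (εn n * u' n x)
  rw [abs_eq_of_Lfun hp]
  have h4 := abs_le.1 (hB x hx)
  have h5 := abs_le.1 (hD _ (hrange n x hx))
  rw [Real.dist_eq] at h1
  have h6 := abs_lt.1 h1
  have h7 := abs_le.1 (hA x hx)
  have h8 : Lfun p (εn n * u' n x) ≤ A * (D + (B + 1)) := by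
    rw [h2]
    calc a x * (W (u n x) - Ener p (εn n) a W (u n) (u' n) x) ≤ a x * (D + (B + 1)) := by
          have := hapos x hx
          gcongr
          linarith
      _ ≤ _ := by gcongr; exact h7.2
  gcongr

/-- The rescaled argument, truncated to `[0, 1]`. -/
def rescale (x0 ε y : ℝ) : ℝ := projIcc (0:ℝ) 1 zero_le_one (x0 + ε * y)

lemma rescale_mem (x0 ε y : ℝ) : rescale x0 ε y ∈ Icc (0:ℝ) 1 := Subtype.coe_prop _

lemma continuous_rescale (x0 : ℝ) : Continuous fun q : ℝ × ℝ => rescale x0 q.1 q.2 := by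
  unfold rescale
  exact continuous_subtype_val.comp (continuous_projIcc.comp (by fun_prop))

lemma continuous_rescale_right (x0 ε : ℝ) : Continuous (rescale x0 ε) :=
  (continuous_rescale x0).comp (by fun_prop : Continuous fun y : ℝ => (ε, y))

lemma rescale_of_mem {x0 ε y : ℝ} (h : x0 + ε * y ∈ Icc (0:ℝ) 1) :
    rescale x0 ε y = x0 + ε * y := by
  rw [rescale, projIcc_of_mem _ h]

lemma dist_rescale_le (x0 : ℝ) {ε : ℝ} (hε : 0 < ε) (y z : ℝ) :
    |rescale x0 ε y - rescale x0 ε z| ≤ ε * |y - z| := by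
  have h := (LipschitzWith.projIcc (zero_le_one (α := ℝ))).dist_le_mul (x0 + ε * y) (x0 + ε * z)
  rw [Subtype.dist_eq, Real.dist_eq, Real.dist_eq, NNReal.coe_one, one_mul] at h
  calc |rescale x0 ε y - rescale x0 ε z| ≤ |x0 + ε * y - (x0 + ε * z)| := h
    _ = ε * |y - z| := by
      rw [add_sub_add_left_eq_sub, ← mul_sub, abs_mul, abs_of_pos hε]

lemma rescale_tendsto {x0 : ℝ} (hx0 : x0 ∈ Ioo (0:ℝ) 1) {εn : ℕ → ℝ}
    (hεn0 : Tendsto εn atTop (𝓝 0)) (R : ℝ) :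
    ∀ᶠ n in atTop, ∀ y ∈ Ioo (-R) R, x0 + εn n * y ∈ Ioo (0:ℝ) 1 := by
  rcases le_or_gt R 0 with hR | hR
  · exact Eventually.of_forall fun n y hy => by linarith [hy.1, hy.2]
  obtain ⟨δ, hδ, hball⟩ := Metric.isOpen_iff.1 isOpen_Ioo x0 hx0
  have h := Metric.tendsto_nhds.1 hεn0 (δ / R) (by positivity)
  filter_upwards [h] with n hn y hy
  apply hball
  rw [Real.dist_0_eq_abs] at hn
  rw [Metric.mem_ball, Real.dist_eq, add_sub_cancel_left, abs_mul]
  have hy' : |y| < R := abs_lt.2 hy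
  calc |εn n| * |y| ≤ δ / R * |y| := by gcongr
    _ < δ / R * R := by gcongr
    _ = δ := by field_simp

/-- A function on `[0, 1]` with derivative bounded by `M / ε` is, after rescaling,
`M`-Lipschitz. -/
lemma lipschitzWith_comp_rescale {f f' : ℝ → ℝ} {ε : ℝ} (hε : 0 < ε) (x0 : ℝ) {M : NNReal}
    (hf : ∀ x ∈ Icc (0:ℝ) 1, HasDerivWithinAt f (f' x) (Icc 0 1) x)
    (hM : ∀ x ∈ Icc (0:ℝ) 1, |ε * f' x| ≤ M) :
    LipschitzWith M (fun y => f (rescale x0 ε y)) := by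
  refine LipschitzWith.of_dist_le_mul fun y z => ?_
  have h := (convex_Icc (0:ℝ) 1).norm_image_sub_le_of_norm_hasDerivWithin_le (C := M / ε) hf
    (fun x hx => by
      have := hM x hx
      rw [abs_mul, abs_of_pos hε] at this
      rwa [le_div_iff₀' hε])
    (rescale_mem x0 ε z) (rescale_mem x0 ε y)
  rw [Real.dist_eq, Real.dist_eq]
  calc |f (rescale x0 ε y) - f (rescale x0 ε z)|
      ≤ M / ε * |rescale x0 ε y - rescale x0 ε z| := h
    _ ≤ M / ε * (ε * |y - z|) := by
        gcongr
        exact dist_rescale_le x0 hε y z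
    _ = M * |y - z| := by field_simp

lemma hasDerivAt_comp_rescale {f f' : ℝ → ℝ} {ε x0 y : ℝ}
    (hf : ∀ x ∈ Icc (0:ℝ) 1, HasDerivWithinAt f (f' x) (Icc 0 1) x)
    (hy : x0 + ε * y ∈ Ioo (0:ℝ) 1) :
    HasDerivAt (fun y => f (rescale x0 ε y)) (ε * f' (rescale x0 ε y)) y := by
  have hmem := Ioo_subset_Icc_self hy
  have h1 : HasDerivAt f (f' (x0 + ε * y)) (x0 + ε * y) :=
    (hf _ hmem).hasDerivAt (Icc_mem_nhds hy.1 hy.2)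
  have h2 : HasDerivAt (fun y => x0 + ε * y) ε y := by
    simpa using ((hasDerivAt_id y).const_mul ε).const_add x0
  have h3 := h1.comp y h2
  rw [rescale_of_mem hmem, mul_comm]
  refine h3.congr_of_eventuallyEq ?_
  filter_upwards [h2.continuousAt.eventually_mem (Ioo_mem_nhds hy.1 hy.2)] with z hz
  rw [rescale_of_mem (Ioo_subset_Icc_self hz), Function.comp_apply]

lemma tendstoLocallyUniformly_of_rescale {x0 : ℝ} (hx0 : x0 ∈ Ioo (0:ℝ) 1) {εn : ℕ → ℝ}
    (hεn0 : Tendsto εn atTop (𝓝 0)) {f : ℕ → ℝ → ℝ} {g : ℝ → ℝ}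
    (h : TendstoLocallyUniformly (fun n y => f n (rescale x0 (εn n) y)) g atTop) :
    TendstoLocallyUniformly (fun n y => f n (x0 + εn n * y)) g atTop := by
  intro s hs x
  obtain ⟨t, ht, hev⟩ := h s hs x
  have hx : x ∈ Ioo (-(|x| + 1)) (|x| + 1) := abs_lt.1 (by linarith)
  refine ⟨t ∩ Ioo (-(|x| + 1)) (|x| + 1), inter_mem ht (isOpen_Ioo.mem_nhds hx), ?_⟩
  filter_upwards [hev, rescale_tendsto hx0 hεn0 (|x| + 1)] with n h1 h2 y hy
  rw [← rescale_of_mem (Ioo_subset_Icc_self (h2 y hy.2))]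
  exact h1 y hy.1

lemma continuousOn_energy {p : ℝ} (hp : 1 < p) {a W : ℝ → ℝ} (hac : Continuous a)
    (hapos : ∀ x ∈ Icc (0:ℝ) 1, 0 < a x) (hWc : Continuous W) {ε : ℝ} {u u' : ℝ → ℝ}
    (h : IsNeumann p ε a W u u') : ContinuousOn (Ener p ε a W u u') (Icc 0 1) := by
  have huc : ContinuousOn u (Icc 0 1) := fun x hx => (h.1.2.1 x hx).continuousWithinAt
  have hu'c := h.1.1
  unfold Ener
  refine ContinuousOn.add (ContinuousOn.mul ?_ ?_) (hWc.comp_continuousOn huc)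
  · exact (continuousOn_const.div hac.continuousOn fun x hx => (hapos x hx).ne').neg
  · exact (continuous_Lfun hp).comp_continuousOn (continuousOn_const.mul hu'c)

/-- Compactness: along a subsequence the rescaled solutions converge to a solution of the
autonomous equation with energy `E x0` and values in `[-1, 1]`. -/
lemma exists_subseq_limit {p : ℝ} (hp : 1 < p) {a W : ℝ → ℝ} (hac : Continuous a)
    (hapos : ∀ x ∈ Icc (0:ℝ) 1, 0 < a x) (hW : ContDiff ℝ 1 W) {εn : ℕ → ℝ}
    (hεn : ∀ n, 0 < εn n) (hεn0 : Tendsto εn atTop (𝓝 0)) {u u' : ℕ → ℝ → ℝ}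
    (hrange : ∀ n, ∀ x ∈ Icc (0:ℝ) 1, u n x ∈ Icc (-1:ℝ) 1)
    (hsol : ∀ n, IsNeumann p (εn n) a W (u n) (u' n)) {E : ℝ → ℝ}
    (hconv : TendstoUniformlyOn (fun n x => Ener p (εn n) a W (u n) (u' n) x) E
      atTop (Icc 0 1)) {x0 : ℝ} (hx0 : x0 ∈ Ioo (0:ℝ) 1) :
    ∃ φ : ℕ → ℕ, StrictMono φ ∧ ∃ vb vb' : ℝ → ℝ,
      IsSolAuto p (a x0) W vb vb' ∧
      (∀ y, -(1 / a x0) * Lfun p (vb' y) + W (vb y) = E x0) ∧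
      TendstoLocallyUniformly (fun n y => u (φ n) (x0 + εn (φ n) * y)) vb atTop ∧
      TendstoLocallyUniformly (fun n y => εn (φ n) * u' (φ n) (x0 + εn (φ n) * y)) vb' atTop ∧
      ∀ y, vb y ∈ Icc (-1:ℝ) 1 := by
  have hWc := hW.continuous
  have hWd : Continuous (deriv W) := hW.continuous_deriv le_rfl
  have hEc : ContinuousOn E (Icc 0 1) := hconv.continuousOn
    (Eventually.of_forall fun n => continuousOn_energy hp hac hapos hWc (hsol n)).frequently
  obtain ⟨N, M, hM0, hM⟩ := exists_uniform_deriv_bound hp hac hapos hWc hrange hconv hEc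
  obtain ⟨A, hA⟩ := (isCompact_Icc (a := (0:ℝ)) (b := 1)).exists_bound_of_continuousOn
    hac.continuousOn
  obtain ⟨D, hD⟩ := (isCompact_Icc (a := (-1:ℝ)) (b := 1)).exists_bound_of_continuousOn
    hWd.continuousOn
  have h0 : (0:ℝ) ∈ Icc (0:ℝ) 1 := by norm_num
  have hA0 : 0 ≤ A := (norm_nonneg _).trans (hA 0 h0)
  have hD0 : 0 ≤ D := (norm_nonneg _).trans (hD 0 (by norm_num))
  choose g hgc hgd hge using fun n => (hsol n).1.2.2
  have huc : ∀ n, ContinuousOn (u n) (Icc 0 1) := fun n x hx =>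
    ((hsol n).1.2.1 x hx).continuousWithinAt
  have hwc : ∀ n, ContinuousOn (fun x => phip p (εn n * u' n x)) (Icc 0 1) := fun n =>
    (continuous_phip hp).comp_continuousOn (continuousOn_const.mul (hsol n).1.1)
  let V : ℕ → C(ℝ, ℝ) := fun n =>
    ⟨fun y => u n (rescale x0 (εn n) y),
      (huc n).comp_continuous (continuous_rescale_right _ _) fun y => rescale_mem _ _ _⟩
  let Z : ℕ → C(ℝ, ℝ) := fun n =>
    ⟨fun y => phip p (εn n * u' n (rescale x0 (εn n) y)),
      (hwc n).comp_continuous (continuous_rescale_right _ _) fun y => rescale_mem _ _ _⟩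
  have hVl : ∀ n, LipschitzWith ⟨M, hM0⟩ (V (n + N)) := fun n =>
    lipschitzWith_comp_rescale (hεn _) x0 (hsol _).1.2.1 (hM _ (by omega))
  have hZl : ∀ n, LipschitzWith ⟨A * D, by positivity⟩ (Z n) := fun n =>
    lipschitzWith_comp_rescale (hεn _) x0 (hgd n) fun x hx => by
      rw [hge n x hx, abs_mul]
      exact mul_le_mul (hA x hx) (hD _ (hrange n x hx)) (abs_nonneg _) hA0
  obtain ⟨v, φ₁, hφ₁, hv⟩ := exists_subseq_tendsto_of_lipschitz hVl (B := 1)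
    fun n x => abs_le.2 (hrange _ _ (rescale_mem _ _ _))
  obtain ⟨z, φ₂, hφ₂, hz⟩ := exists_subseq_tendsto_of_lipschitz
    (f := fun n => Z (φ₁ n + N)) (fun n => hZl _) (B := M ^ (p - 1)) fun n x => by
      change |phip p _| ≤ _
      rw [abs_phip hp]
      exact Real.rpow_le_rpow (abs_nonneg _) (hM _ (by omega) _ (rescale_mem _ _ _))
        (by linarith)
  set φ : ℕ → ℕ := fun n => φ₁ (φ₂ n) + N
  have hφ : StrictMono φ := fun m n hmn => by
    have := hφ₁ (hφ₂ hmn)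
    simp only [φ]; omega
  have hVlim : Tendsto (fun n => V (φ n)) atTop (𝓝 v) := hv.comp hφ₂.tendsto_atTop
  have hZlim : Tendsto (fun n => Z (φ n)) atTop (𝓝 z) := hz
  have hεφ : Tendsto (fun n => εn (φ n)) atTop (𝓝 0) := hεn0.comp hφ.tendsto_atTop
  let ψ : C(ℝ, ℝ) := ⟨phip (p / (p - 1)), continuous_phip (one_lt_conj hp)⟩
  let dW : C(ℝ, ℝ) := ⟨deriv W, hWd⟩
  let aC : C(ℝ × ℝ, ℝ) := ⟨fun q => a (rescale x0 q.1 q.2), hac.comp (continuous_rescale x0)⟩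
  have hψlim : Tendsto (fun n => ψ.comp (Z (φ n))) atTop (𝓝 (ψ.comp z)) :=
    (ψ.continuous_postcomp.tendsto z).comp hZlim
  have hdWlim : Tendsto (fun n => dW.comp (V (φ n))) atTop (𝓝 (dW.comp v)) :=
    (dW.continuous_postcomp.tendsto v).comp hVlim
  have haClim : Tendsto (fun n => aC.curry (εn (φ n))) atTop (𝓝 (aC.curry 0)) :=
    (aC.curry.continuous.tendsto 0).comp hεφ
  have hψZ : ∀ n y, ψ.comp (Z n) y = εn n * u' n (rescale x0 (εn n) y) := fun n y =>
    phip_conj_phip hp _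
  have hr0 : ∀ y, rescale x0 0 y = x0 := fun y => by
    have := Ioo_subset_Icc_self hx0
    rw [rescale_of_mem (by simpa using this)]
    simp
  have hvd : ∀ y, HasDerivAt v (ψ.comp z y) y :=
    hasDerivAt_of_tendsto_continuousMap hVlim hψlim fun R => by
      filter_upwards [rescale_tendsto hx0 hεφ R] with n hn y hy
      rw [hψZ]
      exact hasDerivAt_comp_rescale (hsol _).1.2.1 (hn y hy)
  have hzd : ∀ y, HasDerivAt z (a x0 * deriv W (v y)) y := by
    intro y
    have := hasDerivAt_of_tendsto_continuousMap hZlim (haClim.mul hdWlim) (fun R => by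
      filter_upwards [rescale_tendsto hx0 hεφ R] with n hn y hy
      have h1 := hasDerivAt_comp_rescale (hgd (φ n)) (hn y hy)
      rw [hge _ _ (rescale_mem _ _ _)] at h1
      exact h1) y
    simpa [aC, dW, hr0] using this
  have hpt : ∀ y, Tendsto (fun n => V (φ n) y) atTop (𝓝 (v y)) := fun y =>
    ((continuous_eval_const y).tendsto v).comp hVlim
  have hpt' : ∀ y, Tendsto (fun n => εn (φ n) * u' (φ n) (rescale x0 (εn (φ n)) y)) atTop
      (𝓝 (ψ.comp z y)) := fun y => by
    have := ((continuous_eval_const y).tendsto (ψ.comp z)).comp hψlim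
    simpa only [Function.comp_def, hψZ] using this
  refine ⟨φ, hφ, v, ψ.comp z, ⟨(ψ.comp z).continuous, hvd, fun y => a x0 * deriv W (v y),
    by fun_prop, fun y => ?_, fun y => rfl⟩, fun y => ?_, ?_, ?_, fun y => ?_⟩
  · have : (fun y => phip p (ψ.comp z y)) = z := funext fun y => phip_phip_conj hp (z y)
    rw [this]
    exact hzd y
  · have hxlim : Tendsto (fun n => rescale x0 (εn (φ n)) y) atTop (𝓝 x0) := by
      have h1 : Continuous fun ε : ℝ => rescale x0 ε y :=
        (continuous_rescale x0).comp (by fun_prop : Continuous fun ε : ℝ => (ε, y))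
      have := (h1.tendsto 0).comp hεφ
      rwa [hr0] at this
    have hxlim' : Tendsto (fun n => rescale x0 (εn (φ n)) y) atTop (𝓝[Icc 0 1] x0) :=
      tendsto_nhdsWithin_iff.2 ⟨hxlim, Eventually.of_forall fun n => rescale_mem _ _ _⟩
    have hx0' := Ioo_subset_Icc_self hx0
    have hE1 : Tendsto (fun n => Ener p (εn (φ n)) a W (u (φ n)) (u' (φ n))
        (rescale x0 (εn (φ n)) y)) atTop (𝓝 (E x0)) := by
      have hEx : Tendsto (fun n => E (rescale x0 (εn (φ n)) y)) atTop (𝓝 (E x0)) :=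
        (hEc x0 hx0').tendsto.comp hxlim'
      rw [Metric.tendsto_nhds] at hEx ⊢
      intro δ hδ
      filter_upwards [hEx (δ / 2) (by positivity), hφ.tendsto_atTop.eventually
        (Metric.tendstoUniformlyOn_iff.1 hconv (δ / 2) (by positivity))] with n h1 h2
      have h3 := h2 _ (rescale_mem x0 (εn (φ n)) y)
      rw [dist_comm] at h3
      linarith [dist_triangle (Ener p (εn (φ n)) a W (u (φ n)) (u' (φ n))
        (rescale x0 (εn (φ n)) y)) (E (rescale x0 (εn (φ n)) y)) (E x0)]
    have hE2 : Tendsto (fun n => Ener p (εn (φ n)) a W (u (φ n)) (u' (φ n))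
        (rescale x0 (εn (φ n)) y)) atTop
        (𝓝 (-(1 / a x0) * Lfun p (ψ.comp z y) + W (v y))) := by
      unfold Ener
      refine Tendsto.add (Tendsto.mul ?_ ?_) ?_
      · exact (tendsto_const_nhds.div ((hac.tendsto x0).comp hxlim) (hapos x0 hx0').ne').neg
      · exact ((continuous_Lfun hp).tendsto _).comp (hpt' y)
      · exact (hWc.tendsto _).comp (hpt y)
    exact tendsto_nhds_unique hE2 hE1
  · exact tendstoLocallyUniformly_of_rescale hx0 hεφ
      (ContinuousMap.tendsto_iff_tendstoLocallyUniformly.1 hVlim)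
  · refine tendstoLocallyUniformly_of_rescale hx0 hεφ
      (f := fun n x => εn (φ n) * u' (φ n) x) ?_
    have := ContinuousMap.tendsto_iff_tendstoLocallyUniformly.1 hψlim
    simpa only [hψZ] using this
  · exact isClosed_Icc.mem_of_tendsto (hpt y)
      (Eventually.of_forall fun n => hrange _ _ (rescale_mem _ _ _))

/-- Convergence of the rescaled solutions `v_n(y) = u_n(x₀ + ε_n y)`:
up to a subsequence they converge in `C¹_loc(ℝ)` to a solution `v̄` of the autonomous
equation at `a(x₀)` with constant energy `E(x₀) ∈ [0, W₀]`, and `v̄` is classified according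
to the value of `E(x₀)`. -/
theorem rescaled_solutions_converge
    (p : ℝ) (hp : 1 < p)
    (a : ℝ → ℝ) (haC : ContDiff ℝ 1 a) (hapos : ∀ x ∈ Set.Icc (0:ℝ) 1, 0 < a x)
    (W : ℝ → ℝ) (hW : ContDiff ℝ 1 W)
    (Cm1 C0 C1 W0 : ℝ) (hW1 : W1cond p W Cm1 C0 C1 W0) (hW2 : W2cond p W)
    (εn : ℕ → ℝ) (hεn : ∀ n, 0 < εn n) (hεn0 : Tendsto εn atTop (𝓝 0))
    (u u' : ℕ → ℝ → ℝ)
    (hrange : ∀ n, ∀ x ∈ Set.Icc (0:ℝ) 1, u n x ∈ Set.Icc (-1:ℝ) 1)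
    (hsol : ∀ n, IsNeumann p (εn n) a W (u n) (u' n))
    (E : ℝ → ℝ)
    (hconv : TendstoUniformlyOn (fun n x => Ener p (εn n) a W (u n) (u' n) x) E
      atTop (Set.Icc 0 1))
    (x0 : ℝ) (hx0 : x0 ∈ Set.Ioo (0:ℝ) 1)
    -- the canonical periodic solution of the limit equation with energy `E(x₀)`
    (vper vper' : ℝ → ℝ)
    (hvper : E x0 ∈ Set.Ioo 0 W0 →
      IsSolAuto p (a x0) W vper vper' ∧
      (∀ y, -(1 / a x0) * Lfun p (vper' y) + W (vper y) = E x0) ∧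
      vper 0 = 0 ∧ 0 < vper' 0 ∧ ∃ c > (0:ℝ), Function.Periodic vper c)
    -- the canonical heteroclinic solution of the limit equation with zero energy
    (vhet vhet' : ℝ → ℝ)
    (hvhet : E x0 = 0 →
      IsSolAuto p (a x0) W vhet vhet' ∧
      (∀ y, -(1 / a x0) * Lfun p (vhet' y) + W (vhet y) = 0) ∧
      vhet 0 = 0 ∧ 0 < vhet' 0) :
    ∃ φ : ℕ → ℕ, StrictMono φ ∧ ∃ vb vb' : ℝ → ℝ,
      IsSolAuto p (a x0) W vb vb' ∧
      (∀ y, -(1 / a x0) * Lfun p (vb' y) + W (vb y) = E x0) ∧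
      TendstoLocallyUniformly (fun n y => u (φ n) (x0 + εn (φ n) * y)) vb atTop ∧
      TendstoLocallyUniformly (fun n y => εn (φ n) * u' (φ n) (x0 + εn (φ n) * y)) vb'
        atTop ∧
      E x0 ∈ Set.Icc 0 W0 ∧
      (E x0 ∈ Set.Ioo 0 W0 → ∃ t0 : ℝ, ∀ y, vb y = vper (y + t0)) ∧
      (E x0 = W0 → ∀ y, vb y = 0) ∧
      (E x0 = 0 → (∀ y, vb y = 1) ∨ (∀ y, vb y = -1) ∨
        (∃ t0 : ℝ, (∀ y, vb y = vhet (y + t0)) ∨ (∀ y, vb y = vhet (-y + t0)))) := by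
  have hx0' : x0 ∈ Set.Icc (0:ℝ) 1 := Set.Ioo_subset_Icc_self hx0
  have ha := hapos x0 hx0'
  have hDW := doubleWell_of_conditions hp hW hW1 hW2
  obtain ⟨φ, hφ, vb, vb', hsolb, hen, hlim, hlim', hrb⟩ :=
    exists_subseq_limit hp haC.continuous hapos hW hεn hεn0 hrange hsol hconv hx0
  refine ⟨φ, hφ, vb, vb', hsolb, hen, hlim, hlim', hsolb.energy_mem_Icc hp ha hDW hrb hen,
    fun hE => ?_, fun hE y => ?_, fun hE => ?_⟩
  · obtain ⟨hz, hze, hz0, -, c, hc0, hc⟩ := hvper hE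
    exact hsolb.eq_periodic_translate hp ha hDW hz hrb hen hze hE hz0 hc0 hc
  · by_contra h0
    have h1 := le_of_energy hp ha (hen y)
    have h2 := hDW.lt_top (hrb y) h0
    linarith
  · obtain ⟨hz, hze, hz0, -⟩ := hvhet hE
    exact hsolb.zero_energy_classification hp ha hDW hz hrb (fun y => (hen y).trans hE) hze hz0
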